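/- Let d ≥ 1 be an integer, let σ̃ ≥ 2/d and λ ≥ 0 be real numbers, and let T > 0. Let u : ℝ × ℝ^d → ℂ be infinitely differentiable, such that for every multi-index α, every j ∈ {0,1} and every k ∈ ℕ, sup_{t∈[0,T], x∈ℝ^d} (1+|x|)^k |∂_t^j ∂_x^α u(t,x)| < ∞, and such that i ∂_t u(t,x) = Δ_x u(t,x) + λ |u(t,x)|^{2σ̃} u(t,x) for all (t,x) ∈ [0,T] × ℝ^d. Then for every t ∈ [0,T], G(u(t,·)) ≤ G(u(0,·)) + 4 t H_{σ̃,λ}(u(0,·)). -/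

import Mathlib

open MeasureTheory Complex Filter Topology

noncomputable section

variable {d : ℕ}

/-- The `k`-th partial derivative of a function `u : ℝ^d → ℂ`. -/
def pd (u : EuclideanSpace ℝ (Fin d) → ℂ) (k : Fin d) (x : EuclideanSpace ℝ (Fin d)) : ℂ :=
  fderiv ℝ u x (EuclideanSpace.single k 1)

/-- The second partial derivative `∂_j ∂_k u` of a function `u : ℝ^d → ℂ`. -/
def pd2 (u : EuclideanSpace ℝ (Fin d) → ℂ) (j k : Fin d) (x : EuclideanSpace ℝ (Fin d)) : ℂ :=
  fderiv ℝ (fun y => fderiv ℝ u y (EuclideanSpace.single k 1)) x (EuclideanSpace.single j 1)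

/-- The Laplacian of a function `u : ℝ^d → ℂ`. -/
def lap (u : EuclideanSpace ℝ (Fin d) → ℂ) (x : EuclideanSpace ℝ (Fin d)) : ℂ :=
  ∑ k, pd2 u k k x

/-- The mass `M(v) = ∫ |v|² dx`. -/
def massM (v : EuclideanSpace ℝ (Fin d) → ℂ) : ℝ := ∫ x, ‖v x‖ ^ 2

/-- The energy `H_{σ̃,λ}(v) = (1/2) ∫ |∇v|² dx − (λ/(2σ̃+2)) ∫ |v|^{2σ̃+2} dx`. -/
def energyH (σt lam : ℝ) (v : EuclideanSpace ℝ (Fin d) → ℂ) : ℝ :=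
  (1 / 2) * (∫ x, ∑ k, ‖pd v k x‖ ^ 2)
    - (lam / (2 * σt + 2)) * ∫ x, ‖v x‖ ^ (2 * σt + 2)

/-- The variance `V(v) = ∫ |x|² |v(x)|² dx`. -/
def varV (v : EuclideanSpace ℝ (Fin d) → ℂ) : ℝ := ∫ x, ‖x‖ ^ 2 * ‖v x‖ ^ 2

/-- The momentum `G(v) = Im ∫ v (x·∇v̄) dx`. -/
def momG (v : EuclideanSpace ℝ (Fin d) → ℂ) : ℝ :=
  (∫ x, v x * ∑ k, (x k : ℂ) * (starRingEnd ℂ) (pd v k x)).im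

/-- `u`, together with its first time derivative, is rapidly decreasing in space,
uniformly on the time interval `[0, T]`: for every spatial multi-index (encoded via
the order `n` of the iterated spatial derivative), every `j ∈ {0,1}` and every `k`,
`sup_{t∈[0,T], x} (1+|x|)^k |∂_t^j ∂_x^α u(t,x)| < ∞`. -/
def RapidlyDecreasingOn (T : ℝ) (u : ℝ × EuclideanSpace ℝ (Fin d) → ℂ) : Prop :=
  ∀ n k : ℕ, ∃ C : ℝ, ∀ t ∈ Set.Icc (0 : ℝ) T, ∀ x,
    (1 + ‖x‖) ^ k * ‖iteratedFDeriv ℝ n (fun y => u (t, y)) x‖ ≤ C ∧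
    (1 + ‖x‖) ^ k * ‖iteratedFDeriv ℝ n (fun y => deriv (fun s => u (s, y)) t) x‖ ≤ C

/-- `u` is a classical solution on `[0, T]` of the nonlinear Schrödinger equation
`i ∂_t u = Δu + λ |u|^{2σ̃} u`. -/
def IsNLSSolution (σt lam T : ℝ) (u : ℝ × EuclideanSpace ℝ (Fin d) → ℂ) : Prop :=
  ∀ t ∈ Set.Icc (0 : ℝ) T, ∀ x,
    Complex.I * deriv (fun s => u (s, x)) t
      = lap (fun y => u (t, y)) x
        + ((lam * ‖u (t, x)‖ ^ (2 * σt) : ℝ) : ℂ) * u (t, x)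

/-- The real part `Re (a b̄)`. -/
def reMulConj (a b : ℂ) : ℝ := a.re * b.re + a.im * b.im

/-- The imaginary part `Im (a b̄)`. -/
def imMulConj (a b : ℂ) : ℝ := a.im * b.re - a.re * b.im

lemma norm_sq_eq_reMulConj (a : ℂ) : ‖a‖ ^ 2 = reMulConj a a := by
  rw [Complex.sq_norm, Complex.normSq_apply, reMulConj]

lemma reMulConj_self_nonneg (a : ℂ) : 0 ≤ reMulConj a a := by
  rw [← norm_sq_eq_reMulConj]; positivity

lemma abs_reMulConj_le (a b : ℂ) : |reMulConj a b| ≤ ‖a‖ * ‖b‖ := by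
  have h : reMulConj a b = (a * (starRingEnd ℂ) b).re := by simp [reMulConj]
  rw [h]
  simpa using Complex.abs_re_le_norm (a * (starRingEnd ℂ) b)

lemma abs_imMulConj_le (a b : ℂ) : |imMulConj a b| ≤ ‖a‖ * ‖b‖ := by
  have h : imMulConj a b = (a * (starRingEnd ℂ) b).im := by simp [imMulConj]; ring
  rw [h]
  simpa using Complex.abs_im_le_norm (a * (starRingEnd ℂ) b)

section Derivatives

variable {a b : ℝ → ℂ} {a' b' : ℂ} {s : ℝ}

lemma HasDerivAt.complex_re (ha : HasDerivAt a a' s) :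
    HasDerivAt (fun r => (a r).re) a'.re s :=
  Complex.reCLM.hasFDerivAt.comp_hasDerivAt s ha

lemma HasDerivAt.complex_im (ha : HasDerivAt a a' s) :
    HasDerivAt (fun r => (a r).im) a'.im s :=
  Complex.imCLM.hasFDerivAt.comp_hasDerivAt s ha

lemma HasDerivAt.reMulConj (ha : HasDerivAt a a' s) (hb : HasDerivAt b b' s) :
    HasDerivAt (fun r => reMulConj (a r) (b r))
      (_root_.reMulConj a' (b s) + _root_.reMulConj (a s) b') s := by
  refine ((ha.complex_re.mul hb.complex_re).add
    (ha.complex_im.mul hb.complex_im)).congr_deriv ?_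
  simp only [_root_.reMulConj]; ring

lemma HasDerivAt.imMulConj (ha : HasDerivAt a a' s) (hb : HasDerivAt b b' s) :
    HasDerivAt (fun r => imMulConj (a r) (b r))
      (_root_.imMulConj a' (b s) + _root_.imMulConj (a s) b') s := by
  refine ((ha.complex_im.mul hb.complex_re).sub
    (ha.complex_re.mul hb.complex_im)).congr_deriv ?_
  simp only [_root_.imMulConj]; ring

lemma HasDerivAt.reMulConj_self_rpow {p : ℝ} (hp : 0 < p) (ha : HasDerivAt a a' s) :
    HasDerivAt (fun r => (_root_.reMulConj (a r) (a r)) ^ (p + 1))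
      (2 * (p + 1) * (_root_.reMulConj (a s) (a s)) ^ p * _root_.reMulConj (a s) a') s := by
  refine ((ha.reMulConj ha).rpow_const (p := p + 1) (Or.inr (by linarith))).congr_deriv ?_
  rw [add_sub_cancel_right]
  simp only [_root_.reMulConj]; ring

end Derivatives

/-- A continuous function on space-time which decreases rapidly in space, uniformly on the
time interval `[0, T]`. -/
structure UniformlyDecaying {F : Type*} [NormedAddCommGroup F] (T : ℝ)
    (f : ℝ × EuclideanSpace ℝ (Fin d) → F) : Prop where
  continuous : Continuous f
  bound : ∀ k : ℕ, ∃ C : ℝ, ∀ t ∈ Set.Icc (0 : ℝ) T, ∀ x, (1 + ‖x‖) ^ k * ‖f (t, x)‖ ≤ C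

namespace UniformlyDecaying

variable {F : Type*} [NormedAddCommGroup F] {T : ℝ}

lemma add {f g : ℝ × EuclideanSpace ℝ (Fin d) → F} (hf : UniformlyDecaying T f)
    (hg : UniformlyDecaying T g) : UniformlyDecaying T (fun z => f z + g z) := by
  refine ⟨hf.continuous.add hg.continuous, fun k => ?_⟩
  obtain ⟨A, hA⟩ := hf.bound k
  obtain ⟨B, hB⟩ := hg.bound k
  refine ⟨A + B, fun t ht x => ?_⟩
  calc (1 + ‖x‖) ^ k * ‖f (t, x) + g (t, x)‖
      ≤ (1 + ‖x‖) ^ k * (‖f (t, x)‖ + ‖g (t, x)‖) := by gcongr; exact norm_add_le _ _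
    _ ≤ A + B := by rw [mul_add]; exact add_le_add (hA t ht x) (hB t ht x)

lemma sum {ι : Type*} (s : Finset ι) {f : ι → ℝ × EuclideanSpace ℝ (Fin d) → F}
    (hf : ∀ i ∈ s, UniformlyDecaying T (f i)) :
    UniformlyDecaying T (fun z => ∑ i ∈ s, f i z) := by
  classical
  induction s using Finset.induction_on with
  | empty => exact ⟨by simpa using continuous_const, fun k => ⟨0, by simp⟩⟩
  | insert i s hi ih =>
    simp only [Finset.sum_insert hi]
    exact (hf i (Finset.mem_insert_self i s)).add
      (ih fun j hj => hf j (Finset.mem_insert_of_mem hj))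

lemma of_norm_le_mul {F₁ F₂ : Type*} [NormedAddCommGroup F₁] [NormedAddCommGroup F₂]
    {f : ℝ × EuclideanSpace ℝ (Fin d) → F} {g : ℝ × EuclideanSpace ℝ (Fin d) → F₁}
    {h : ℝ × EuclideanSpace ℝ (Fin d) → F₂} (hf : Continuous f)
    (hg : UniformlyDecaying T g) (hh : UniformlyDecaying T h)
    (hle : ∀ z, ‖f z‖ ≤ ‖g z‖ * ‖h z‖) : UniformlyDecaying T f := by
  refine ⟨hf, fun k => ?_⟩
  obtain ⟨A, hA⟩ := hg.bound k
  obtain ⟨B, hB⟩ := hh.bound 0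
  refine ⟨A * B, fun t ht x => ?_⟩
  have hA' := hA t ht x
  have hB' := hB t ht x
  rw [pow_zero, one_mul] at hB'
  calc (1 + ‖x‖) ^ k * ‖f (t, x)‖
      ≤ (1 + ‖x‖) ^ k * (‖g (t, x)‖ * ‖h (t, x)‖) := by gcongr; exact hle _
    _ = ((1 + ‖x‖) ^ k * ‖g (t, x)‖) * ‖h (t, x)‖ := by ring
    _ ≤ A * B := by
      gcongr
      exact le_trans (by positivity) hA'

lemma reMulConj {f g : ℝ × EuclideanSpace ℝ (Fin d) → ℂ} (hf : UniformlyDecaying T f)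
    (hg : UniformlyDecaying T g) : UniformlyDecaying T (fun z => reMulConj (f z) (g z)) := by
  have h1 := hf.continuous
  have h2 := hg.continuous
  refine of_norm_le_mul ?_ hf hg fun z => abs_reMulConj_le _ _
  unfold _root_.reMulConj
  fun_prop

lemma imMulConj {f g : ℝ × EuclideanSpace ℝ (Fin d) → ℂ} (hf : UniformlyDecaying T f)
    (hg : UniformlyDecaying T g) : UniformlyDecaying T (fun z => imMulConj (f z) (g z)) := by
  have h1 := hf.continuous
  have h2 := hg.continuous
  refine of_norm_le_mul ?_ hf hg fun z => abs_imMulConj_le _ _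
  unfold _root_.imMulConj
  fun_prop

lemma const_mul {f : ℝ × EuclideanSpace ℝ (Fin d) → ℝ} (c : ℝ) (hf : UniformlyDecaying T f) :
    UniformlyDecaying T (fun z => c * f z) := by
  refine ⟨continuous_const.mul hf.continuous, fun k => ?_⟩
  obtain ⟨A, hA⟩ := hf.bound k
  refine ⟨|c| * A, fun t ht x => ?_⟩
  rw [norm_mul, Real.norm_eq_abs, mul_left_comm]
  exact mul_le_mul_of_nonneg_left (hA t ht x) (abs_nonneg c)

lemma sub {f g : ℝ × EuclideanSpace ℝ (Fin d) → ℝ} (hf : UniformlyDecaying T f)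
    (hg : UniformlyDecaying T g) : UniformlyDecaying T (fun z => f z - g z) := by
  simpa only [neg_one_mul, ← sub_eq_add_neg] using hf.add (hg.const_mul (-1))

lemma coord_mul {f : ℝ × EuclideanSpace ℝ (Fin d) → ℝ} (j : Fin d)
    (hf : UniformlyDecaying T f) : UniformlyDecaying T (fun z => z.2 j * f z) := by
  have h1 := hf.continuous
  refine ⟨by fun_prop, fun k => ?_⟩
  obtain ⟨A, hA⟩ := hf.bound (k + 1)
  refine ⟨A, fun t ht x => le_trans ?_ (hA t ht x)⟩
  have hx : ‖x j‖ ≤ 1 + ‖x‖ := (PiLp.norm_apply_le x j).trans (by linarith)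
  rw [norm_mul, pow_succ, mul_assoc]
  gcongr

lemma rpow_mul {f g : ℝ × EuclideanSpace ℝ (Fin d) → ℝ} {p : ℝ} (hp : 0 < p)
    (hf : UniformlyDecaying T f) (hf0 : ∀ z, 0 ≤ f z) (hg : UniformlyDecaying T g) :
    UniformlyDecaying T (fun z => f z ^ p * g z) := by
  refine ⟨(hf.continuous.rpow_const fun _ => Or.inr hp.le).mul hg.continuous, fun k => ?_⟩
  obtain ⟨A, hA⟩ := hg.bound k
  obtain ⟨B, hB⟩ := hf.bound 0
  refine ⟨B ^ p * A, fun t ht x => ?_⟩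
  have hA' := hA t ht x
  have hB' := hB t ht x
  have h0 := hf0 (t, x)
  rw [pow_zero, one_mul, Real.norm_of_nonneg h0] at hB'
  rw [norm_mul, Real.norm_of_nonneg (Real.rpow_nonneg h0 p), mul_left_comm]
  have hB0 := h0.trans hB'
  gcongr

lemma rpow_add_one {f : ℝ × EuclideanSpace ℝ (Fin d) → ℝ} {p : ℝ} (hp : 0 < p)
    (hf : UniformlyDecaying T f) (hf0 : ∀ z, 0 ≤ f z) :
    UniformlyDecaying T (fun z => f z ^ (p + 1)) := by
  have h : (fun z => f z ^ (p + 1)) = fun z => f z ^ p * f z := by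
    funext z
    rw [Real.rpow_add_one' (hf0 z) (by positivity)]
  rw [h]
  exact hf.rpow_mul hp hf0 hf

lemma exists_integrable_bound {f : ℝ × EuclideanSpace ℝ (Fin d) → F}
    (hf : UniformlyDecaying T f) : ∃ B : EuclideanSpace ℝ (Fin d) → ℝ, Integrable B ∧
      ∀ t ∈ Set.Icc (0 : ℝ) T, ∀ x, ‖f (t, x)‖ ≤ B x := by
  obtain ⟨A, hA⟩ := hf.bound (d + 1)
  refine ⟨fun x => A * (1 + ‖x‖) ^ (-((d + 1 : ℕ) : ℝ)),
    (integrable_one_add_norm (by simp)).const_mul A, fun t ht x => ?_⟩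
  have hx : 0 < 1 + ‖x‖ := by positivity
  beta_reduce
  rw [Real.rpow_neg hx.le, Real.rpow_natCast, ← div_eq_mul_inv, le_div_iff₀ (by positivity),
    mul_comm]
  exact hA t ht x

lemma continuous_slice {f : ℝ × EuclideanSpace ℝ (Fin d) → F}
    (hf : UniformlyDecaying T f) (t : ℝ) : Continuous fun x => f (t, x) :=
  hf.continuous.comp (by fun_prop)

lemma integrable {f : ℝ × EuclideanSpace ℝ (Fin d) → F}
    (hf : UniformlyDecaying T f) {t : ℝ} (ht : t ∈ Set.Icc (0 : ℝ) T) :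
    Integrable fun x => f (t, x) := by
  obtain ⟨B, hB, hle⟩ := hf.exists_integrable_bound
  exact hB.mono' (hf.continuous_slice t).aestronglyMeasurable (.of_forall (hle t ht))

/-- The integral of the line derivative of a decaying function vanishes. -/
lemma integral_lineDeriv_eq_zero {f f' : ℝ × EuclideanSpace ℝ (Fin d) → ℝ}
    (hf : UniformlyDecaying T f) (hf' : UniformlyDecaying T f') {t : ℝ}
    (ht : t ∈ Set.Icc (0 : ℝ) T) {w : EuclideanSpace ℝ (Fin d)}
    (hd : ∀ x, HasDerivAt (fun s : ℝ => f (t, x + s • w)) (f' (t, x)) 0) :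
    ∫ x, f' (t, x) = 0 := by
  have h := integral_bilinear_hasLineDerivAt_right_eq_neg_left_of_integrable
    (μ := (volume : Measure (EuclideanSpace ℝ (Fin d))))
    (f := fun _ => (1 : ℝ)) (f' := fun _ => (0 : ℝ))
    (g := fun x => f (t, x)) (g' := fun x => f' (t, x)) (v := w)
    (B := ContinuousLinearMap.mul ℝ ℝ) (by simp)
    (by simpa using hf'.integrable ht) (by simpa using hf.integrable ht)
    (fun x _ => hasDerivAt_const _ _) (fun x _ => hd x)
  simpa using h

/-- An upper bound on the integrated time derivative bounds the growth of the integral. -/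
lemma integral_le_of_integral_deriv_le {f f' : ℝ × EuclideanSpace ℝ (Fin d) → ℝ} {C : ℝ}
    (hf : UniformlyDecaying T f) (hf' : UniformlyDecaying T f')
    (hd : ∀ t x, HasDerivAt (fun s : ℝ => f (s, x)) (f' (t, x)) t)
    (hC : ∀ t ∈ Set.Icc (0 : ℝ) T, ∫ x, f' (t, x) ≤ C) {t : ℝ} (ht : t ∈ Set.Icc (0 : ℝ) T) :
    ∫ x, f (t, x) ≤ (∫ x, f (0, x)) + C * t := by
  obtain ⟨A, hA, hfA⟩ := hf.exists_integrable_bound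
  obtain ⟨B, hB, hfB⟩ := hf'.exists_integrable_bound
  have hder : ∀ r ∈ Set.Ioo (0 : ℝ) T,
      HasDerivAt (fun r => ∫ x, f (r, x)) (∫ x, f' (r, x)) r := fun r hr =>
    (hasDerivAt_integral_of_dominated_loc_of_deriv_le (Icc_mem_nhds hr.1 hr.2)
      (.of_forall fun r => (hf.continuous_slice r).aestronglyMeasurable)
      (hf.integrable (Set.Ioo_subset_Icc_self hr))
      (hf'.continuous_slice r).aestronglyMeasurable
      (.of_forall fun x s hs => hfB s hs x) hB (.of_forall fun x s _ => hd s x)).2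
  have hcont : ContinuousOn (fun r => ∫ x, f (r, x)) (Set.Icc 0 T) :=
    continuousOn_of_dominated (fun r _ => (hf.continuous_slice r).aestronglyMeasurable)
      (fun r hr => .of_forall (hfA r hr)) hA
      (.of_forall fun x r _ => (hd r x).continuousAt.continuousWithinAt)
  have h := (convex_Icc (0 : ℝ) T).image_sub_le_mul_sub_of_deriv_le (C := C) hcont
    (by
      rw [interior_Icc]
      exact fun r hr => (hder r hr).differentiableAt.differentiableWithinAt)
    (by
      rw [interior_Icc]
      intro r hr
      rw [(hder r hr).deriv]
      exact hC r (Set.Ioo_subset_Icc_self hr))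
    0 (Set.left_mem_Icc.2 (ht.1.trans ht.2)) t ht ht.1
  linarith

end UniformlyDecaying

/-- The derivative of a function on space-time in the direction `w`. -/
def dirDeriv (w : ℝ × EuclideanSpace ℝ (Fin d)) (f : ℝ × EuclideanSpace ℝ (Fin d) → ℂ)
    (z : ℝ × EuclideanSpace ℝ (Fin d)) : ℂ :=
  fderiv ℝ f z w

section DirDeriv

variable {f : ℝ × EuclideanSpace ℝ (Fin d) → ℂ}

lemma ContDiff.dirDeriv (hf : ContDiff ℝ (⊤ : ℕ∞) f) (w : ℝ × EuclideanSpace ℝ (Fin d)) :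
    ContDiff ℝ (⊤ : ℕ∞) (dirDeriv w f) :=
  (hf.fderiv_right (m := (⊤ : ℕ∞)) (by simp)).clm_apply contDiff_const

lemma dirDeriv_comm (hf : ContDiff ℝ (⊤ : ℕ∞) f) (w w' : ℝ × EuclideanSpace ℝ (Fin d)) :
    dirDeriv w (dirDeriv w' f) = dirDeriv w' (dirDeriv w f) := by
  have h1 : Differentiable ℝ (fderiv ℝ f) :=
    (hf.fderiv_right (m := (⊤ : ℕ∞)) (by simp)).differentiable (by simp)
  have key : ∀ v v' z, dirDeriv v (dirDeriv v' f) z = fderiv ℝ (fderiv ℝ f) z v v' := by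
    intro v v' z
    have := ((h1 z).hasFDerivAt.clm_apply (hasFDerivAt_const v' z)).fderiv
    simp only [dirDeriv]
    change fderiv ℝ (fun y => fderiv ℝ f y v') z v = _
    rw [this]; simp
  funext z
  rw [key, key]
  exact second_derivative_symmetric
    (fun y => ((hf.differentiable (by simp)) y).hasFDerivAt) (h1 z).hasFDerivAt w w'

lemma hasDerivAt_time (hf : ContDiff ℝ (⊤ : ℕ∞) f) (t : ℝ) (x : EuclideanSpace ℝ (Fin d)) :
    HasDerivAt (fun s : ℝ => f (s, x)) (dirDeriv (1, 0) f (t, x)) t :=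
  ((hf.differentiable (by simp)) (t, x)).hasFDerivAt.comp_hasDerivAt t
    ((hasDerivAt_id t).prodMk (hasDerivAt_const t x))

lemma hasDerivAt_space (hf : ContDiff ℝ (⊤ : ℕ∞) f) (t : ℝ) (x w : EuclideanSpace ℝ (Fin d)) :
    HasDerivAt (fun s : ℝ => f (t, x + s • w)) (dirDeriv (0, w) f (t, x)) 0 := by
  have hγ : HasDerivAt (fun s : ℝ => (t, x + s • w)) (0, w) 0 := by
    refine (hasDerivAt_const (0 : ℝ) t).prodMk ?_
    simpa using ((hasDerivAt_id (0 : ℝ)).smul_const w).const_add x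
  have hz : HasFDerivAt f (fderiv ℝ f (t, x)) ((fun s : ℝ => (t, x + s • w)) 0) := by
    simpa using ((hf.differentiable (by simp)) (t, x)).hasFDerivAt
  exact hz.comp_hasDerivAt 0 hγ

lemma fderiv_slice (hf : ContDiff ℝ (⊤ : ℕ∞) f) (t : ℝ) (x w : EuclideanSpace ℝ (Fin d)) :
    fderiv ℝ (fun y => f (t, y)) x w = dirDeriv (0, w) f (t, x) := by
  have h := ((hf.differentiable (by simp)) (t, x)).hasFDerivAt.comp x
    ((hasFDerivAt_const t x).prodMk (hasFDerivAt_id x))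
  have h' : HasFDerivAt (fun y => f (t, y)) _ x := h
  rw [h'.fderiv]
  simp [dirDeriv]

lemma norm_dirDeriv_space_le (hf : ContDiff ℝ (⊤ : ℕ∞) f) (t : ℝ)
    (x w : EuclideanSpace ℝ (Fin d)) :
    ‖dirDeriv (0, w) f (t, x)‖ ≤ ‖iteratedFDeriv ℝ 1 (fun y => f (t, y)) x‖ * ‖w‖ := by
  rw [← fderiv_slice hf, norm_iteratedFDeriv_one]
  exact ContinuousLinearMap.le_opNorm _ _

lemma norm_dirDeriv_dirDeriv_space_le (hf : ContDiff ℝ (⊤ : ℕ∞) f) (t : ℝ)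
    (x w w' : EuclideanSpace ℝ (Fin d)) :
    ‖dirDeriv (0, w') (dirDeriv (0, w) f) (t, x)‖ ≤
      ‖iteratedFDeriv ℝ 2 (fun y => f (t, y)) x‖ * ‖w'‖ * ‖w‖ := by
  have hslice : ContDiff ℝ (⊤ : ℕ∞) (fun y => f (t, y)) :=
    hf.comp (contDiff_const.prodMk contDiff_id)
  have h1 : Differentiable ℝ (fderiv ℝ (fun y => f (t, y))) :=
    (hslice.fderiv_right (m := (⊤ : ℕ∞)) (by simp)).differentiable (by simp)
  have h2 : dirDeriv (0, w') (dirDeriv (0, w) f) (t, x) =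
      fderiv ℝ (fderiv ℝ (fun y => f (t, y))) x w' w := by
    rw [← fderiv_slice (hf.dirDeriv _)]
    simp only [← fderiv_slice hf]
    rw [((h1 x).hasFDerivAt.clm_apply (hasFDerivAt_const w x)).fderiv]
    simp
  rw [h2, ← norm_iteratedFDeriv_fderiv, norm_iteratedFDeriv_one]
  exact ContinuousLinearMap.le_opNorm₂ _ _ _

end DirDeriv

section Decay

variable {T : ℝ} {u : ℝ × EuclideanSpace ℝ (Fin d) → ℂ}

lemma time_deriv_eq_dirDeriv (hu : ContDiff ℝ (⊤ : ℕ∞) u) (t : ℝ)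
    (x : EuclideanSpace ℝ (Fin d)) :
    deriv (fun s => u (s, x)) t = dirDeriv (1, 0) u (t, x) :=
  (hasDerivAt_time hu t x).deriv

lemma RapidlyDecreasingOn.uniformlyDecaying (h : RapidlyDecreasingOn T u)
    (hu : ContDiff ℝ (⊤ : ℕ∞) u) : UniformlyDecaying T u := by
  refine ⟨hu.continuous, fun k => ?_⟩
  obtain ⟨C, hC⟩ := h 0 k
  exact ⟨C, fun t ht x => by simpa using (hC t ht x).1⟩

lemma RapidlyDecreasingOn.uniformlyDecaying_time (h : RapidlyDecreasingOn T u)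
    (hu : ContDiff ℝ (⊤ : ℕ∞) u) : UniformlyDecaying T (dirDeriv (1, 0) u) := by
  refine ⟨(hu.dirDeriv _).continuous, fun k => ?_⟩
  obtain ⟨C, hC⟩ := h 0 k
  refine ⟨C, fun t ht x => ?_⟩
  simpa [time_deriv_eq_dirDeriv hu] using (hC t ht x).2

lemma RapidlyDecreasingOn.uniformlyDecaying_space (h : RapidlyDecreasingOn T u)
    (hu : ContDiff ℝ (⊤ : ℕ∞) u) (w : EuclideanSpace ℝ (Fin d)) :
    UniformlyDecaying T (dirDeriv (0, w) u) := by
  refine ⟨(hu.dirDeriv _).continuous, fun k => ?_⟩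
  obtain ⟨C, hC⟩ := h 1 k
  refine ⟨C * ‖w‖, fun t ht x => ?_⟩
  calc _ ≤ (1 + ‖x‖) ^ k * (‖iteratedFDeriv ℝ 1 (fun y => u (t, y)) x‖ * ‖w‖) := by
        gcongr; exact norm_dirDeriv_space_le hu t x w
    _ ≤ C * ‖w‖ := by rw [← mul_assoc]; gcongr; exact (hC t ht x).1

lemma RapidlyDecreasingOn.uniformlyDecaying_space_time (h : RapidlyDecreasingOn T u)
    (hu : ContDiff ℝ (⊤ : ℕ∞) u) (w : EuclideanSpace ℝ (Fin d)) :
    UniformlyDecaying T (dirDeriv (0, w) (dirDeriv (1, 0) u)) := by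
  have hv := hu.dirDeriv (1, 0)
  refine ⟨(hv.dirDeriv _).continuous, fun k => ?_⟩
  obtain ⟨C, hC⟩ := h 1 k
  refine ⟨C * ‖w‖, fun t ht x => ?_⟩
  have hC' := (hC t ht x).2
  simp only [time_deriv_eq_dirDeriv hu] at hC'
  calc _ ≤ (1 + ‖x‖) ^ k *
        (‖iteratedFDeriv ℝ 1 (fun y => dirDeriv (1, 0) u (t, y)) x‖ * ‖w‖) := by
        gcongr; exact norm_dirDeriv_space_le hv t x w
    _ ≤ C * ‖w‖ := by rw [← mul_assoc]; gcongr

lemma RapidlyDecreasingOn.uniformlyDecaying_space_space (h : RapidlyDecreasingOn T u)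
    (hu : ContDiff ℝ (⊤ : ℕ∞) u) (w' w : EuclideanSpace ℝ (Fin d)) :
    UniformlyDecaying T (dirDeriv (0, w') (dirDeriv (0, w) u)) := by
  refine ⟨((hu.dirDeriv _).dirDeriv _).continuous, fun k => ?_⟩
  obtain ⟨C, hC⟩ := h 2 k
  refine ⟨C * ‖w'‖ * ‖w‖, fun t ht x => ?_⟩
  calc _ ≤ (1 + ‖x‖) ^ k * (‖iteratedFDeriv ℝ 2 (fun y => u (t, y)) x‖ * ‖w'‖ * ‖w‖) := by
        gcongr; exact norm_dirDeriv_dirDeriv_space_le hu t x w w'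
    _ ≤ C * ‖w'‖ * ‖w‖ := by rw [← mul_assoc, ← mul_assoc]; gcongr; exact (hC t ht x).1

end Decay

/-- The `k`-th spatial partial derivative of a function on space-time. -/
def spaceDeriv (k : Fin d) (f : ℝ × EuclideanSpace ℝ (Fin d) → ℂ) :
    ℝ × EuclideanSpace ℝ (Fin d) → ℂ :=
  dirDeriv (0, EuclideanSpace.single k 1) f

/-- The time derivative of a function on space-time. -/
def timeDeriv (f : ℝ × EuclideanSpace ℝ (Fin d) → ℂ) : ℝ × EuclideanSpace ℝ (Fin d) → ℂ :=
  dirDeriv (1, 0) f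

/-- The squared modulus of the spatial gradient. -/
def gradSq (u : ℝ × EuclideanSpace ℝ (Fin d) → ℂ) (z : ℝ × EuclideanSpace ℝ (Fin d)) : ℝ :=
  ∑ j, reMulConj (spaceDeriv j u z) (spaceDeriv j u z)

/-- The density `|u|^{2p+2}`. -/
def powDensity (p : ℝ) (u : ℝ × EuclideanSpace ℝ (Fin d) → ℂ)
    (z : ℝ × EuclideanSpace ℝ (Fin d)) : ℝ :=
  reMulConj (u z) (u z) ^ (p + 1)

/-- The directional derivative of `powDensity`, where `u'` is that of `u`. -/
def powDensityDeriv (p : ℝ) (u u' : ℝ × EuclideanSpace ℝ (Fin d) → ℂ)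
    (z : ℝ × EuclideanSpace ℝ (Fin d)) : ℝ :=
  2 * (p + 1) * reMulConj (u z) (u z) ^ p * reMulConj (u z) (u' z)

/-- The momentum density `Im (u x·∇ū)`. -/
def momDensity (u : ℝ × EuclideanSpace ℝ (Fin d) → ℂ) (z : ℝ × EuclideanSpace ℝ (Fin d)) : ℝ :=
  ∑ k, z.2 k * imMulConj (u z) (spaceDeriv k u z)

/-- The time derivative of the momentum density. -/
def momDensityDeriv (u : ℝ × EuclideanSpace ℝ (Fin d) → ℂ)
    (z : ℝ × EuclideanSpace ℝ (Fin d)) : ℝ :=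
  ∑ k, z.2 k * (imMulConj (timeDeriv u z) (spaceDeriv k u z)
    + imMulConj (u z) (spaceDeriv k (timeDeriv u) z))

/-- The `k`-th component of the momentum flux. -/
def momFlux (p lam : ℝ) (u : ℝ × EuclideanSpace ℝ (Fin d) → ℂ) (k : Fin d)
    (z : ℝ × EuclideanSpace ℝ (Fin d)) : ℝ :=
  z.2 k * imMulConj (u z) (timeDeriv u z)
    - 2 * ∑ j, z.2 j * reMulConj (spaceDeriv k u z) (spaceDeriv j u z)
    + z.2 k * gradSq u z
    - d * reMulConj (spaceDeriv k u z) (u z)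
    - lam / (p + 1) * (z.2 k * powDensity p u z)

/-- The derivative of `momFlux p lam u k` in the direction of the `k`-th coordinate. -/
def momFluxDeriv (p lam : ℝ) (u : ℝ × EuclideanSpace ℝ (Fin d) → ℂ) (k : Fin d)
    (z : ℝ × EuclideanSpace ℝ (Fin d)) : ℝ :=
  (imMulConj (u z) (timeDeriv u z) + z.2 k * (imMulConj (spaceDeriv k u z) (timeDeriv u z)
      + imMulConj (u z) (spaceDeriv k (timeDeriv u) z)))
    - 2 * (reMulConj (spaceDeriv k u z) (spaceDeriv k u z)
      + ∑ j, z.2 j * (reMulConj (spaceDeriv k (spaceDeriv k u) z) (spaceDeriv j u z)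
        + reMulConj (spaceDeriv k u z) (spaceDeriv k (spaceDeriv j u) z)))
    + (gradSq u z
      + z.2 k * ∑ j, (reMulConj (spaceDeriv k (spaceDeriv j u) z) (spaceDeriv j u z)
        + reMulConj (spaceDeriv j u z) (spaceDeriv k (spaceDeriv j u) z)))
    - d * (reMulConj (spaceDeriv k (spaceDeriv k u) z) (u z)
      + reMulConj (spaceDeriv k u z) (spaceDeriv k u z))
    - lam / (p + 1) * (powDensity p u z + z.2 k * powDensityDeriv p u (spaceDeriv k u) z)

/-- The energy density. -/
def energyDensity (p lam : ℝ) (u : ℝ × EuclideanSpace ℝ (Fin d) → ℂ)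
    (z : ℝ × EuclideanSpace ℝ (Fin d)) : ℝ :=
  (1 / 2) * gradSq u z - lam / (2 * p + 2) * powDensity p u z

/-- The time derivative of the energy density. -/
def energyDensityDeriv (p lam : ℝ) (u : ℝ × EuclideanSpace ℝ (Fin d) → ℂ)
    (z : ℝ × EuclideanSpace ℝ (Fin d)) : ℝ :=
  (1 / 2) * ∑ k, (reMulConj (spaceDeriv k (timeDeriv u) z) (spaceDeriv k u z)
      + reMulConj (spaceDeriv k u z) (spaceDeriv k (timeDeriv u) z))
    - lam / (2 * p + 2) * powDensityDeriv p u (timeDeriv u) z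

/-- The derivative in the direction of the `k`-th coordinate of the `k`-th component
`Re (∂_k u ∂_t ū)` of the energy flux. -/
def energyFluxDeriv (u : ℝ × EuclideanSpace ℝ (Fin d) → ℂ) (k : Fin d)
    (z : ℝ × EuclideanSpace ℝ (Fin d)) : ℝ :=
  reMulConj (spaceDeriv k (spaceDeriv k u) z) (timeDeriv u z)
    + reMulConj (spaceDeriv k u z) (spaceDeriv k (timeDeriv u) z)

section Densities

variable {u : ℝ × EuclideanSpace ℝ (Fin d) → ℂ} {p lam : ℝ}

lemma timeDeriv_spaceDeriv (hu : ContDiff ℝ (⊤ : ℕ∞) u) (k : Fin d) :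
    timeDeriv (spaceDeriv k u) = spaceDeriv k (timeDeriv u) :=
  dirDeriv_comm hu _ _

lemma spaceDeriv_comm (hu : ContDiff ℝ (⊤ : ℕ∞) u) (j k : Fin d) :
    spaceDeriv j (spaceDeriv k u) = spaceDeriv k (spaceDeriv j u) :=
  dirDeriv_comm hu _ _

lemma ContDiff.spaceDeriv (hu : ContDiff ℝ (⊤ : ℕ∞) u) (k : Fin d) :
    ContDiff ℝ (⊤ : ℕ∞) (spaceDeriv k u) :=
  hu.dirDeriv _

lemma ContDiff.timeDeriv (hu : ContDiff ℝ (⊤ : ℕ∞) u) : ContDiff ℝ (⊤ : ℕ∞) (timeDeriv u) :=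
  hu.dirDeriv _

lemma pd_slice (hu : ContDiff ℝ (⊤ : ℕ∞) u) (k : Fin d) (t : ℝ)
    (x : EuclideanSpace ℝ (Fin d)) :
    pd (fun y => u (t, y)) k x = spaceDeriv k u (t, x) :=
  fderiv_slice hu t x _

lemma pd2_slice (hu : ContDiff ℝ (⊤ : ℕ∞) u) (j k : Fin d) (t : ℝ)
    (x : EuclideanSpace ℝ (Fin d)) :
    pd2 (fun y => u (t, y)) j k x = spaceDeriv j (spaceDeriv k u) (t, x) := by
  unfold pd2
  simp only [fderiv_slice hu]
  exact fderiv_slice (hu.spaceDeriv k) t x _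

lemma hasDerivAt_coord (j : Fin d) (x w : EuclideanSpace ℝ (Fin d)) :
    HasDerivAt (fun s : ℝ => (x + s • w) j) (w j) 0 := by
  simpa using ((hasDerivAt_id (0 : ℝ)).mul_const (w j)).const_add (x j)

lemma hasDerivAt_momDensity (hu : ContDiff ℝ (⊤ : ℕ∞) u) (t : ℝ)
    (x : EuclideanSpace ℝ (Fin d)) :
    HasDerivAt (fun s : ℝ => momDensity u (s, x)) (momDensityDeriv u (t, x)) t := by
  refine HasDerivAt.fun_sum fun k _ => ?_
  rw [← timeDeriv_spaceDeriv hu]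
  exact ((hasDerivAt_time hu t x).imMulConj
    (hasDerivAt_time (hu.spaceDeriv k) t x)).const_mul (x k)

lemma hasDerivAt_energyDensity (hp : 0 < p) (hu : ContDiff ℝ (⊤ : ℕ∞) u) (t : ℝ)
    (x : EuclideanSpace ℝ (Fin d)) :
    HasDerivAt (fun s : ℝ => energyDensity p lam u (s, x))
      (energyDensityDeriv p lam u (t, x)) t := by
  refine HasDerivAt.sub (HasDerivAt.const_mul _ (HasDerivAt.fun_sum fun k _ => ?_))
    (((hasDerivAt_time hu t x).reMulConj_self_rpow hp).const_mul _)
  rw [← timeDeriv_spaceDeriv hu]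
  exact (hasDerivAt_time (hu.spaceDeriv k) t x).reMulConj
    (hasDerivAt_time (hu.spaceDeriv k) t x)

lemma hasDerivAt_energyFlux (hu : ContDiff ℝ (⊤ : ℕ∞) u) (k : Fin d) (t : ℝ)
    (x : EuclideanSpace ℝ (Fin d)) :
    HasDerivAt (fun s : ℝ => reMulConj
        (spaceDeriv k u (t, x + s • EuclideanSpace.single k (1 : ℝ)))
        (timeDeriv u (t, x + s • EuclideanSpace.single k (1 : ℝ))))
      (energyFluxDeriv u k (t, x)) 0 := by
  refine ((hasDerivAt_space (hu.spaceDeriv k) t x _).reMulConj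
    (hasDerivAt_space hu.timeDeriv t x _)).congr_deriv ?_
  simp only [zero_smul, add_zero]
  rfl

lemma hasDerivAt_momFlux (hp : 0 < p) (hu : ContDiff ℝ (⊤ : ℕ∞) u) (k : Fin d) (t : ℝ)
    (x : EuclideanSpace ℝ (Fin d)) :
    HasDerivAt (fun s : ℝ => momFlux p lam u k (t, x + s • EuclideanSpace.single k (1 : ℝ)))
      (momFluxDeriv p lam u k (t, x)) 0 := by
  have hc := fun j => hasDerivAt_coord j x (EuclideanSpace.single k (1 : ℝ))
  have h0 := hasDerivAt_space hu t x (EuclideanSpace.single k (1 : ℝ))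
  have h1 := fun j => hasDerivAt_space (hu.spaceDeriv j) t x (EuclideanSpace.single k (1 : ℝ))
  have hv := hasDerivAt_space hu.timeDeriv t x (EuclideanSpace.single k (1 : ℝ))
  have hgrad := HasDerivAt.fun_sum (u := Finset.univ) fun j _ => (h1 j).reMulConj (h1 j)
  have hcross := HasDerivAt.fun_sum (u := Finset.univ)
    fun j _ => (hc j).fun_mul ((h1 k).reMulConj (h1 j))
  refine ((((((hc k).fun_mul (h0.imMulConj hv)).sub (hcross.const_mul 2)).add
    ((hc k).fun_mul hgrad)).sub (((h1 k).reMulConj h0).const_mul (d : ℝ))).sub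
    (((hc k).fun_mul (h0.reMulConj_self_rpow hp)).const_mul (lam / (p + 1)))).congr_deriv ?_
  simp only [zero_smul, add_zero, Finset.sum_add_distrib, PiLp.single_apply, ite_mul, one_mul,
    zero_mul, Finset.sum_ite_eq', Finset.mem_univ, if_true]
  simp only [momFluxDeriv, Finset.sum_add_distrib]
  rfl

end Densities

section Decay

variable {u : ℝ × EuclideanSpace ℝ (Fin d) → ℂ} {p lam T : ℝ}

lemma RapidlyDecreasingOn.gradSq (h : RapidlyDecreasingOn T u) (hu : ContDiff ℝ (⊤ : ℕ∞) u) :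
    UniformlyDecaying T (gradSq u) :=
  .sum _ fun _ _ => (h.uniformlyDecaying_space hu _).reMulConj (h.uniformlyDecaying_space hu _)

lemma RapidlyDecreasingOn.powDensity (hp : 0 < p) (h : RapidlyDecreasingOn T u)
    (hu : ContDiff ℝ (⊤ : ℕ∞) u) : UniformlyDecaying T (powDensity p u) :=
  ((h.uniformlyDecaying hu).reMulConj (h.uniformlyDecaying hu)).rpow_add_one hp
    fun _ => reMulConj_self_nonneg _

lemma RapidlyDecreasingOn.powDensityDeriv (hp : 0 < p) (h : RapidlyDecreasingOn T u)
    (hu : ContDiff ℝ (⊤ : ℕ∞) u) {u' : ℝ × EuclideanSpace ℝ (Fin d) → ℂ}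
    (hu' : UniformlyDecaying T u') : UniformlyDecaying T (powDensityDeriv p u u') := by
  have h0 := h.uniformlyDecaying hu
  have := ((h0.reMulConj h0).rpow_mul hp (fun _ => reMulConj_self_nonneg _)
    (h0.reMulConj hu')).const_mul (2 * (p + 1))
  simp only [← mul_assoc] at this
  exact this

lemma RapidlyDecreasingOn.momDensity (h : RapidlyDecreasingOn T u)
    (hu : ContDiff ℝ (⊤ : ℕ∞) u) : UniformlyDecaying T (momDensity u) :=
  .sum _ fun k _ =>
    ((h.uniformlyDecaying hu).imMulConj (h.uniformlyDecaying_space hu _)).coord_mul k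

lemma RapidlyDecreasingOn.momDensityDeriv (h : RapidlyDecreasingOn T u)
    (hu : ContDiff ℝ (⊤ : ℕ∞) u) : UniformlyDecaying T (momDensityDeriv u) :=
  .sum _ fun k _ =>
    (((h.uniformlyDecaying_time hu).imMulConj (h.uniformlyDecaying_space hu _)).add
      ((h.uniformlyDecaying hu).imMulConj (h.uniformlyDecaying_space_time hu _))).coord_mul k

lemma RapidlyDecreasingOn.energyDensity (hp : 0 < p) (h : RapidlyDecreasingOn T u)
    (hu : ContDiff ℝ (⊤ : ℕ∞) u) : UniformlyDecaying T (energyDensity p lam u) :=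
  ((h.gradSq hu).const_mul _).sub ((h.powDensity hp hu).const_mul _)

lemma RapidlyDecreasingOn.energyDensityDeriv (hp : 0 < p) (h : RapidlyDecreasingOn T u)
    (hu : ContDiff ℝ (⊤ : ℕ∞) u) : UniformlyDecaying T (energyDensityDeriv p lam u) :=
  (UniformlyDecaying.const_mul _ (.sum _ fun _ _ =>
    ((h.uniformlyDecaying_space_time hu _).reMulConj (h.uniformlyDecaying_space hu _)).add
      ((h.uniformlyDecaying_space hu _).reMulConj (h.uniformlyDecaying_space_time hu _)))).sub
    ((h.powDensityDeriv hp hu (h.uniformlyDecaying_time hu)).const_mul _)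

lemma RapidlyDecreasingOn.energyFluxDeriv (h : RapidlyDecreasingOn T u)
    (hu : ContDiff ℝ (⊤ : ℕ∞) u) (k : Fin d) : UniformlyDecaying T (energyFluxDeriv u k) :=
  ((h.uniformlyDecaying_space_space hu _ _).reMulConj (h.uniformlyDecaying_time hu)).add
    ((h.uniformlyDecaying_space hu _).reMulConj (h.uniformlyDecaying_space_time hu _))

lemma RapidlyDecreasingOn.momFlux (hp : 0 < p) (h : RapidlyDecreasingOn T u)
    (hu : ContDiff ℝ (⊤ : ℕ∞) u) (k : Fin d) : UniformlyDecaying T (momFlux p lam u k) := by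
  have h0 := h.uniformlyDecaying hu
  have h1 := fun w => h.uniformlyDecaying_space hu w
  exact ((((((h0.imMulConj (h.uniformlyDecaying_time hu)).coord_mul k).sub
    (UniformlyDecaying.const_mul 2 (.sum _ fun j _ =>
      ((h1 _).reMulConj (h1 _)).coord_mul j))).add
    ((h.gradSq hu).coord_mul k)).sub (((h1 _).reMulConj h0).const_mul _)).sub
    (((h.powDensity hp hu).coord_mul k).const_mul _))

lemma RapidlyDecreasingOn.momFluxDeriv (hp : 0 < p) (h : RapidlyDecreasingOn T u)
    (hu : ContDiff ℝ (⊤ : ℕ∞) u) (k : Fin d) : UniformlyDecaying T (momFluxDeriv p lam u k) := by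
  have h0 := h.uniformlyDecaying hu
  have hv := h.uniformlyDecaying_time hu
  have h1 := fun w => h.uniformlyDecaying_space hu w
  have h2 := fun w w' => h.uniformlyDecaying_space_space hu w w'
  exact (((((h0.imMulConj hv).add ((((h1 _).imMulConj hv).add
      (h0.imMulConj (h.uniformlyDecaying_space_time hu _))).coord_mul k)).sub
    ((((h1 _).reMulConj (h1 _)).add (.sum _ fun j _ =>
      (((h2 _ _).reMulConj (h1 _)).add
        ((h1 _).reMulConj (h2 _ _))).coord_mul j)).const_mul 2)).add
    ((h.gradSq hu).add (UniformlyDecaying.coord_mul k (.sum _ fun j _ =>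
      ((h2 _ _).reMulConj (h1 _)).add ((h1 _).reMulConj (h2 _ _)))))).sub
    ((((h2 _ _).reMulConj h0).add ((h1 _).reMulConj (h1 _))).const_mul _)).sub
    (((h.powDensity hp hu).add
      ((h.powDensityDeriv hp hu (h1 _)).coord_mul k)).const_mul _)

end Decay

section Identities

variable {u : ℝ × EuclideanSpace ℝ (Fin d) → ℂ} {p lam T : ℝ}

lemma IsNLSSolution.re_im (h : IsNLSSolution p lam T u) (hu : ContDiff ℝ (⊤ : ℕ∞) u) {t : ℝ}
    (ht : t ∈ Set.Icc (0 : ℝ) T) (x : EuclideanSpace ℝ (Fin d)) :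
    (timeDeriv u (t, x)).re = ∑ k, (spaceDeriv k (spaceDeriv k u) (t, x)).im
        + lam * reMulConj (u (t, x)) (u (t, x)) ^ p * (u (t, x)).im ∧
    (timeDeriv u (t, x)).im = -(∑ k, (spaceDeriv k (spaceDeriv k u) (t, x)).re
        + lam * reMulConj (u (t, x)) (u (t, x)) ^ p * (u (t, x)).re) := by
  have hz := h t ht x
  have hpow : ‖u (t, x)‖ ^ (2 * p) = reMulConj (u (t, x)) (u (t, x)) ^ p := by
    rw [← norm_sq_eq_reMulConj, Real.rpow_mul (norm_nonneg _), Real.rpow_two]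
  rw [hpow, time_deriv_eq_dirDeriv hu] at hz
  simp only [lap, pd2_slice hu] at hz
  have hre := congrArg Complex.re hz
  have him := congrArg Complex.im hz
  simp only [Complex.mul_re, Complex.mul_im, Complex.I_re, Complex.I_im, Complex.add_re,
    Complex.add_im, Complex.re_sum, Complex.im_sum, Complex.ofReal_re, Complex.ofReal_im]
    at hre him
  unfold timeDeriv
  constructor <;> linarith

lemma energyDensityDeriv_eq (hp : 0 < p) (h : IsNLSSolution p lam T u)
    (hu : ContDiff ℝ (⊤ : ℕ∞) u) {t : ℝ} (ht : t ∈ Set.Icc (0 : ℝ) T)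
    (x : EuclideanSpace ℝ (Fin d)) :
    energyDensityDeriv p lam u (t, x) = ∑ k, energyFluxDeriv u k (t, x) := by
  obtain ⟨hre, him⟩ := h.re_im hu ht x
  have hp1 : p + 1 ≠ 0 := by positivity
  have hp2 : 2 * p + 2 ≠ 0 := by positivity
  simp only [energyDensityDeriv, energyFluxDeriv, powDensityDeriv, reMulConj,
    Finset.sum_add_distrib, ← Finset.sum_mul] at hre him ⊢
  rw [hre, him]
  simp only [mul_comm (Complex.re (spaceDeriv _ (timeDeriv u) (t, x))),
    mul_comm (Complex.im (spaceDeriv _ (timeDeriv u) (t, x)))]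
  field_simp
  ring

lemma momDensityDeriv_eq (hp : 0 < p) (h : IsNLSSolution p lam T u)
    (hu : ContDiff ℝ (⊤ : ℕ∞) u) {t : ℝ} (ht : t ∈ Set.Icc (0 : ℝ) T)
    (x : EuclideanSpace ℝ (Fin d)) :
    momDensityDeriv u (t, x) = 2 * gradSq u (t, x)
      - lam * p * d / (p + 1) * powDensity p u (t, x) + ∑ k, momFluxDeriv p lam u k (t, x) := by
  obtain ⟨hre, him⟩ := h.re_im hu ht x
  have hp1 : p + 1 ≠ 0 := by positivity
  have hpow : powDensity p u (t, x) = reMulConj (u (t, x)) (u (t, x)) ^ p *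
      reMulConj (u (t, x)) (u (t, x)) :=
    Real.rpow_add_one' (reMulConj_self_nonneg _) hp1
  have hcross : ∑ k, ∑ j, x j * reMulConj (spaceDeriv k u (t, x))
        (spaceDeriv k (spaceDeriv j u) (t, x)) =
      ∑ k, ∑ j, x k * reMulConj (spaceDeriv j u (t, x))
        (spaceDeriv k (spaceDeriv j u) (t, x)) := by
    rw [Finset.sum_comm]
    exact Finset.sum_congr rfl fun k _ => Finset.sum_congr rfl fun j _ => by
      rw [spaceDeriv_comm hu]
  have hflux : ∑ k, momFluxDeriv p lam u k (t, x) =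
      d * imMulConj (u (t, x)) (timeDeriv u (t, x))
      + ∑ k, x k * imMulConj (spaceDeriv k u (t, x)) (timeDeriv u (t, x))
      + ∑ k, x k * imMulConj (u (t, x)) (spaceDeriv k (timeDeriv u) (t, x))
      - 2 * gradSq u (t, x)
      - 2 * ∑ k, ∑ j, x j * reMulConj (spaceDeriv k (spaceDeriv k u) (t, x))
        (spaceDeriv j u (t, x))
      - d * ∑ k, reMulConj (spaceDeriv k (spaceDeriv k u) (t, x)) (u (t, x))
      - lam / (p + 1) * (d * powDensity p u (t, x)
        + ∑ k, x k * powDensityDeriv p u (spaceDeriv k u) (t, x)) := by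
    have hsymm : ∀ a b, reMulConj a b = reMulConj b a := fun a b => by
      simp only [reMulConj]; ring
    have hdouble : ∑ k, x k * (∑ j, reMulConj (spaceDeriv k (spaceDeriv j u) (t, x))
        (spaceDeriv j u (t, x)) + ∑ j, reMulConj (spaceDeriv j u (t, x))
          (spaceDeriv k (spaceDeriv j u) (t, x))) =
        2 * ∑ k, ∑ j, x j * reMulConj (spaceDeriv k u (t, x))
          (spaceDeriv k (spaceDeriv j u) (t, x)) := by
      rw [hcross]
      simp only [← Finset.sum_add_distrib, Finset.mul_sum]
      refine Finset.sum_congr rfl fun k _ => Finset.sum_congr rfl fun j _ => ?_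
      rw [hsymm]; ring
    simp only [momFluxDeriv, Finset.sum_sub_distrib, Finset.sum_add_distrib, ← Finset.mul_sum]
    rw [hdouble]
    simp only [mul_add, Finset.sum_add_distrib, Finset.sum_const, Finset.card_univ,
      Fintype.card_fin, nsmul_eq_mul]
    simp only [gradSq]
    ring
  have hB : ∀ a : ℂ, ∑ j, x j * reMulConj a (spaceDeriv j u (t, x)) =
      a.re * ∑ j, x j * (spaceDeriv j u (t, x)).re
        + a.im * ∑ j, x j * (spaceDeriv j u (t, x)).im := fun a => by
    simp only [Finset.mul_sum, ← Finset.sum_add_distrib, reMulConj]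
    exact Finset.sum_congr rfl fun j _ => by ring
  have hI : ∀ a : ℂ, ∑ j, x j * imMulConj a (spaceDeriv j u (t, x)) =
      a.im * ∑ j, x j * (spaceDeriv j u (t, x)).re
        - a.re * ∑ j, x j * (spaceDeriv j u (t, x)).im := fun a => by
    simp only [Finset.mul_sum, ← Finset.sum_sub_distrib, imMulConj]
    exact Finset.sum_congr rfl fun j _ => by ring
  have hI' : ∀ a : ℂ, ∑ j, x j * imMulConj (spaceDeriv j u (t, x)) a =
      a.re * ∑ j, x j * (spaceDeriv j u (t, x)).im
        - a.im * ∑ j, x j * (spaceDeriv j u (t, x)).re := fun a => by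
    simp only [Finset.mul_sum, ← Finset.sum_sub_distrib, imMulConj]
    exact Finset.sum_congr rfl fun j _ => by ring
  have hP : ∑ k, x k * powDensityDeriv p u (spaceDeriv k u) (t, x) =
      2 * (p + 1) * reMulConj (u (t, x)) (u (t, x)) ^ p *
        ∑ k, x k * reMulConj (u (t, x)) (spaceDeriv k u (t, x)) := by
    simp only [Finset.mul_sum, powDensityDeriv]
    exact Finset.sum_congr rfl fun j _ => by ring
  have hQ : ∑ k, reMulConj (spaceDeriv k (spaceDeriv k u) (t, x)) (u (t, x)) =
      (∑ k, (spaceDeriv k (spaceDeriv k u) (t, x)).re) * (u (t, x)).re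
        + (∑ k, (spaceDeriv k (spaceDeriv k u) (t, x)).im) * (u (t, x)).im := by
    simp only [reMulConj, Finset.sum_add_distrib, ← Finset.sum_mul]
  rw [hflux, hP, hQ]
  simp only [momDensityDeriv, mul_add, Finset.sum_add_distrib, hB, hI, hI', hpow,
    ← Finset.sum_mul]
  generalize reMulConj (u (t, x)) (u (t, x)) ^ p = q at hre him ⊢
  simp only [reMulConj, imMulConj]
  rw [hre, him]
  field_simp
  ring

end Identities

section Integrals

variable {u : ℝ × EuclideanSpace ℝ (Fin d) → ℂ} {p lam T : ℝ}

lemma momG_eq_integral (h : RapidlyDecreasingOn T u) (hu : ContDiff ℝ (⊤ : ℕ∞) u) {t : ℝ}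
    (ht : t ∈ Set.Icc (0 : ℝ) T) : momG (fun y => u (t, y)) = ∫ x, momDensity u (t, x) := by
  have hr : UniformlyDecaying T
      (fun z => ∑ k, z.2 k * reMulConj (u z) (spaceDeriv k u z)) :=
    .sum _ fun k _ =>
      ((h.uniformlyDecaying hu).reMulConj (h.uniformlyDecaying_space hu _)).coord_mul k
  have hsplit : (fun x => u (t, x) * ∑ k, (x k : ℂ) *
      (starRingEnd ℂ) (pd (fun y => u (t, y)) k x)) = fun x =>
      ((∑ k, x k * reMulConj (u (t, x)) (spaceDeriv k u (t, x)) : ℝ) : ℂ)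
        + (momDensity u (t, x) : ℂ) * Complex.I := by
    funext x
    simp only [pd_slice hu, momDensity, Complex.ofReal_sum, Finset.mul_sum, Finset.sum_mul,
      ← Finset.sum_add_distrib]
    refine Finset.sum_congr rfl fun k _ => ?_
    apply Complex.ext <;> simp [reMulConj, imMulConj] <;> ring
  have hint : Integrable (fun x =>
      ((∑ k, x k * reMulConj (u (t, x)) (spaceDeriv k u (t, x)) : ℝ) : ℂ)
        + (momDensity u (t, x) : ℂ) * Complex.I) :=
    (hr.integrable ht).ofReal.add (((h.momDensity hu).integrable ht).ofReal.mul_const _)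
  unfold momG
  rw [hsplit]
  have him := integral_im hint
  simpa using him.symm

lemma integral_energyDensity (hp : 0 < p) (h : RapidlyDecreasingOn T u)
    (hu : ContDiff ℝ (⊤ : ℕ∞) u) {t : ℝ} (ht : t ∈ Set.Icc (0 : ℝ) T) :
    ∫ x, energyDensity p lam u (t, x) =
      (1 / 2) * (∫ x, gradSq u (t, x)) - lam / (2 * p + 2) * ∫ x, powDensity p u (t, x) := by
  simp only [energyDensity]
  rw [integral_sub (((h.gradSq hu).integrable ht).const_mul _)
    (((h.powDensity hp hu).integrable ht).const_mul _), integral_const_mul, integral_const_mul]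

lemma energyH_eq_integral (hp : 0 < p) (h : RapidlyDecreasingOn T u)
    (hu : ContDiff ℝ (⊤ : ℕ∞) u) {t : ℝ} (ht : t ∈ Set.Icc (0 : ℝ) T) :
    energyH p lam (fun y => u (t, y)) = ∫ x, energyDensity p lam u (t, x) := by
  have hpow : ∀ x, ‖u (t, x)‖ ^ (2 * p + 2) = powDensity p u (t, x) := fun x => by
    rw [powDensity, ← norm_sq_eq_reMulConj, ← Real.rpow_two, ← Real.rpow_mul (norm_nonneg _)]
    ring_nf
  rw [integral_energyDensity hp h hu ht]
  simp only [energyH, hpow, pd_slice hu, norm_sq_eq_reMulConj]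
  rfl

lemma integral_energyDensityDeriv (hp : 0 < p) (hdec : RapidlyDecreasingOn T u)
    (hu : ContDiff ℝ (⊤ : ℕ∞) u) (h : IsNLSSolution p lam T u) {t : ℝ}
    (ht : t ∈ Set.Icc (0 : ℝ) T) : ∫ x, energyDensityDeriv p lam u (t, x) = 0 := by
  simp only [energyDensityDeriv_eq hp h hu ht]
  rw [integral_finsetSum _ fun k _ => (hdec.energyFluxDeriv hu k).integrable ht]
  exact Finset.sum_eq_zero fun k _ =>
    ((hdec.uniformlyDecaying_space hu _).reMulConj
      (hdec.uniformlyDecaying_time hu)).integral_lineDeriv_eq_zero (hdec.energyFluxDeriv hu k) ht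
      fun x => hasDerivAt_energyFlux hu k t x

lemma integral_momDensityDeriv (hp : 0 < p) (hdec : RapidlyDecreasingOn T u)
    (hu : ContDiff ℝ (⊤ : ℕ∞) u) (h : IsNLSSolution p lam T u) {t : ℝ}
    (ht : t ∈ Set.Icc (0 : ℝ) T) :
    ∫ x, momDensityDeriv u (t, x) = 2 * (∫ x, gradSq u (t, x))
      - lam * p * d / (p + 1) * ∫ x, powDensity p u (t, x) := by
  have hK := ((hdec.gradSq hu).integrable ht).const_mul 2
  have hD := ((hdec.powDensity hp hu).integrable ht).const_mul (lam * p * d / (p + 1))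
  have hKD : Integrable fun x => 2 * gradSq u (t, x)
      - lam * p * d / (p + 1) * powDensity p u (t, x) := hK.sub hD
  have hW := fun k => (hdec.momFluxDeriv (lam := lam) hp hu k).integrable ht
  have hW0 : ∀ k, ∫ x, momFluxDeriv p lam u k (t, x) = 0 := fun k =>
    (hdec.momFlux hp hu k).integral_lineDeriv_eq_zero (hdec.momFluxDeriv hp hu k) ht
      fun x => hasDerivAt_momFlux hp hu k t x
  simp only [momDensityDeriv_eq hp h hu ht]
  rw [integral_add hKD (integrable_finsetSum _ fun k _ => hW k), integral_sub hK hD,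
    integral_finsetSum _ fun k _ => hW k, integral_const_mul, integral_const_mul]
  simp [hW0]

/-- The energy of a solution does not increase. -/
lemma energyH_le (hp : 0 < p) (hdec : RapidlyDecreasingOn T u)
    (hu : ContDiff ℝ (⊤ : ℕ∞) u) (h : IsNLSSolution p lam T u) {t : ℝ}
    (ht : t ∈ Set.Icc (0 : ℝ) T) :
    energyH p lam (fun y => u (t, y)) ≤ energyH p lam (fun y => u (0, y)) := by
  have h0 : (0 : ℝ) ∈ Set.Icc (0 : ℝ) T := Set.left_mem_Icc.2 (ht.1.trans ht.2)
  rw [energyH_eq_integral hp hdec hu ht, energyH_eq_integral hp hdec hu h0]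
  simpa using (hdec.energyDensity hp hu).integral_le_of_integral_deriv_le (C := 0)
    (hdec.energyDensityDeriv hp hu) (hasDerivAt_energyDensity hp hu)
    (fun s hs => (integral_energyDensityDeriv hp hdec hu h hs).le) ht

/-- In the critical and supercritical regime the momentum grows at rate at most four times
the energy. -/
lemma integral_momDensityDeriv_le (hp : 0 < p) (hpd : 2 ≤ p * d) (hlam : 0 ≤ lam)
    (hdec : RapidlyDecreasingOn T u) (hu : ContDiff ℝ (⊤ : ℕ∞) u)
    (h : IsNLSSolution p lam T u) {t : ℝ} (ht : t ∈ Set.Icc (0 : ℝ) T) :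
    ∫ x, momDensityDeriv u (t, x) ≤ 4 * energyH p lam (fun y => u (t, y)) := by
  rw [integral_momDensityDeriv hp hdec hu h ht, energyH_eq_integral hp hdec hu ht,
    integral_energyDensity hp hdec hu ht]
  have hD : 0 ≤ ∫ x, powDensity p u (t, x) :=
    integral_nonneg fun x => Real.rpow_nonneg (reMulConj_self_nonneg _) _
  have hcoef : 4 * (lam / (2 * p + 2)) ≤ lam * p * d / (p + 1) := by
    have hp1 : 0 < p + 1 := by positivity
    have : 4 * (lam / (2 * p + 2)) = lam * 2 / (p + 1) := by field_simp; ring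
    rw [this, mul_assoc lam]
    gcongr
  have := mul_le_mul_of_nonneg_right hcoef hD
  linarith

end Integrals

/-- The momentum bound `G(u(t)) ≤ G(u(0)) + 4t H_{σ̃,λ}(u(0))` used in the proof of
Proposition 5.2, valid in the critical and supercritical regime `σ̃ ≥ 2/d`. -/
theorem momentum_bound_NLS
    (hd : 1 ≤ d) {σt lam : ℝ} (hσt : 2 / (d : ℝ) ≤ σt) (hlam : 0 ≤ lam)
    {T : ℝ} (hT : 0 < T)
    (u : ℝ × EuclideanSpace ℝ (Fin d) → ℂ)
    (hu_smooth : ContDiff ℝ (⊤ : ℕ∞) u)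
    (hu_decay : RapidlyDecreasingOn T u)
    (hu_eq : IsNLSSolution σt lam T u) :
    ∀ t ∈ Set.Icc (0 : ℝ) T,
      momG (fun y => u (t, y))
        ≤ momG (fun y => u (0, y)) + 4 * t * energyH σt lam (fun y => u (0, y)) := by
  intro t ht
  have hd0 : (0 : ℝ) < d := by exact_mod_cast hd
  have hp : 0 < σt := (by positivity : (0 : ℝ) < 2 / d).trans_le hσt
  have hpd : 2 ≤ σt * d := (div_le_iff₀ hd0).1 hσt
  rw [momG_eq_integral hu_decay hu_smooth ht,
    momG_eq_integral hu_decay hu_smooth (Set.left_mem_Icc.2 hT.le), mul_right_comm]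
  exact (hu_decay.momDensity hu_smooth).integral_le_of_integral_deriv_le
    (hu_decay.momDensityDeriv hu_smooth) (hasDerivAt_momDensity hu_smooth)
    (fun s hs =>
      (integral_momDensityDeriv_le hp hpd hlam hu_decay hu_smooth hu_eq hs).trans
        (mul_le_mul_of_nonneg_left (energyH_le hp hu_decay hu_smooth hu_eq hs) (by norm_num)))
    ht
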